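/- arXiv:1007.1764 — 2 statements merged into one kernel-verified Lean document; each statement's English description precedes it below -/
import Mathlib

section
/- For all integers 0 ≤ l ≤ n, the Kelvin transform K(A_n^l) is monogenic on ℝ³ ∖ {0} (∂̄K(A_n^l) = 0 there) and homogeneous of degree −(n+2): K(A_n^l)(t·x) = t^{−(n+2)}·K(A_n^l)(x) for all real t > 0 and all x ∈ ℝ³ ∖ {0}. -/
open MeasureTheory Metric Finset

noncomputable section

/-- `ℝ³` with the Euclidean norm and Lebesgue measure. -/
abbrev R3 := EuclideanSpace ℝ (Fin 3)
/-- the real quaternions ℍ -/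
abbrev QH := Quaternion ℝ

/-- the basis quaternion e₁ -/
def e1 : QH := ⟨0,1,0,0⟩
/-- the basis quaternion e₂ -/
def e2 : QH := ⟨0,0,1,0⟩
/-- the basis quaternion e₃ -/
def e3 : QH := ⟨0,0,0,1⟩

/-- embed a point of ℝ³ as the reduced quaternion x₀ + x₁e₁ + x₂e₂ -/
def toQ (x : R3) : QH := ⟨x 0, x 1, x 2, 0⟩
/-- the conjugate reduced quaternion x₀ - x₁e₁ - x₂e₂ -/
def toQbar (x : R3) : QH := ⟨x 0, -(x 1), -(x 2), 0⟩
/-- ζ = x₁ - x₂e₃ -/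
def zeta (x : R3) : QH := ⟨x 1, 0, 0, -(x 2)⟩

/-- build a point of ℝ³ from coordinates -/
def mk3 (a b c : ℝ) : R3 := (WithLp.equiv 2 (Fin 3 → ℝ)).symm ![a, b, c]

/-- the conjugated point (x₀, -x₁, -x₂) -/
def barPt (x : R3) : R3 := mk3 (x 0) (-(x 1)) (-(x 2))

/-- partial derivative ∂f/∂xᵢ -/
def pd (i : Fin 3) (f : R3 → QH) (x : R3) : QH :=
  fderiv ℝ f x (EuclideanSpace.single i 1)

/-- the generalized Cauchy-Riemann operator ∂̄f = ∂f/∂x₀ + e₁∂f/∂x₁ + e₂∂f/∂x₂ -/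
def CRbar (f : R3 → QH) (x : R3) : QH :=
  pd 0 f x + e1 * pd 1 f x + e2 * pd 2 f x

/-- the adjoint generalized Cauchy-Riemann operator ∂f = ∂f/∂x₀ - e₁∂f/∂x₁ - e₂∂f/∂x₂ -/
def Dadj (f : R3 → QH) (x : R3) : QH :=
  pd 0 f x - e1 * pd 1 f x - e2 * pd 2 f x

/-- the hypercomplex derivative ∂₀ = (1/2)∂ -/
def D0 (f : R3 → QH) : R3 → QH := fun x =>
  (1/2 : ℝ) • (pd 0 f x - e1 * pd 1 f x - e2 * pd 2 f x)

/-- the operator ∂̄_ℂ f = (1/2)(∂f/∂x₁ + e₃∂f/∂x₂) -/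
def DbarC (f : R3 → QH) : R3 → QH := fun x =>
  (1/2 : ℝ) • (pd 1 f x + e3 * pd 2 f x)

/-- the involution f⁰ + f¹e₁ + f²e₂ + f³e₃ ↦ f⁰ - f¹e₁ - f²e₂ + f³e₃ -/
def invol (a : QH) : QH := ⟨a.re, -a.imI, -a.imJ, a.imK⟩

/-- the inner Appell polynomial A_n^l -/
def appell (n l : ℕ) (x : R3) : QH :=
  ((n.factorial * l.factorial : ℝ) /
      (2 ^ (2 * (n - l)) * (n + l + 1).factorial * (2 * l).factorial)) •
    ((∑ h ∈ Finset.range (n - l + 1),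
        (((2 * n - 2 * h + 1).factorial * (2 * l + 2 * h).factorial : ℝ) /
            (h.factorial * (n - l - h).factorial * (n - h).factorial * (l + h).factorial)) •
          (toQbar x ^ h * toQ x ^ (n - l - h))) * zeta x ^ l)

/-- the Kelvin transform K(P)(x) = (x̄/|x|³)·P(x̄/|x|²) -/
def kelvin (P : R3 → QH) (x : R3) : QH :=
  ((‖x‖ ^ 3)⁻¹ • toQbar x) * P ((‖x‖ ^ 2)⁻¹ • barPt x)

/-- the outer Appell function A_{-(n+2)}^l -/
def outerAppell (n l : ℕ) (x : R3) : QH :=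
  (((n + l + 1).factorial * (n - l).factorial : ℝ) / (n.factorial * (n + 1).factorial)) •
    kelvin (appell n l) x

/-- surface integral over the sphere of radius ρ (parametrized by the unit sphere
with its surface measure, with the Jacobian factor ρ²) -/
def sphereIntegral (ρ : ℝ) (g : R3 → QH) : QH :=
  ∫ ω : sphere (0 : R3) 1, (ρ ^ 2) • g (ρ • (ω : R3)) ∂((volume : Measure R3).toSphere)

/-- the unified family ψ_k^l, k ∈ ℤ \ {-1}: inner Appell polynomials for k ≥ 0,
outer Appell functions for k ≤ -2 -/
def psiFam (k : ℤ) (l : ℕ) (x : R3) : QH :=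
  if 0 ≤ k then appell k.toNat l x else outerAppell (-k - 2).toNat l x

open scoped Quaternion

@[simp] theorem toQ_re (x : R3) : (toQ x).re = x 0 := rfl
@[simp] theorem toQ_imI (x : R3) : (toQ x).imI = x 1 := rfl
@[simp] theorem toQ_imJ (x : R3) : (toQ x).imJ = x 2 := rfl
@[simp] theorem toQ_imK (x : R3) : (toQ x).imK = 0 := rfl

@[simp] theorem toQbar_re (x : R3) : (toQbar x).re = x 0 := rfl
@[simp] theorem toQbar_imI (x : R3) : (toQbar x).imI = -x 1 := rfl
@[simp] theorem toQbar_imJ (x : R3) : (toQbar x).imJ = -x 2 := rfl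
@[simp] theorem toQbar_imK (x : R3) : (toQbar x).imK = 0 := rfl

@[simp] theorem zeta_re (x : R3) : (zeta x).re = x 1 := rfl
@[simp] theorem zeta_imI (x : R3) : (zeta x).imI = 0 := rfl
@[simp] theorem zeta_imJ (x : R3) : (zeta x).imJ = 0 := rfl
@[simp] theorem zeta_imK (x : R3) : (zeta x).imK = -x 2 := rfl

@[simp] theorem e1_re : (e1).re = 0 := rfl
@[simp] theorem e1_imI : (e1).imI = 1 := rfl
@[simp] theorem e1_imJ : (e1).imJ = 0 := rfl
@[simp] theorem e1_imK : (e1).imK = 0 := rfl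

@[simp] theorem e2_re : (e2).re = 0 := rfl
@[simp] theorem e2_imI : (e2).imI = 0 := rfl
@[simp] theorem e2_imJ : (e2).imJ = 1 := rfl
@[simp] theorem e2_imK : (e2).imK = 0 := rfl

theorem pd_mul {f g : R3 → QH} {x : R3} (hf : DifferentiableAt ℝ f x)
    (hg : DifferentiableAt ℝ g x) (i : Fin 3) :
    pd i (fun y => f y * g y) x = pd i f x * g x + f x * pd i g x := by
  simp [pd, fderiv_fun_mul' hf hg, add_comm]

theorem CRbar_mul {f g : R3 → QH} {x : R3} (hf : DifferentiableAt ℝ f x)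
    (hg : DifferentiableAt ℝ g x) :
    CRbar (fun y => f y * g y) x = CRbar f x * g x +
      (f x * pd 0 g x + e1 * f x * pd 1 g x + e2 * f x * pd 2 g x) := by
  simp only [CRbar, pd_mul hf hg]
  noncomm_ring

theorem CRbar_const_smul {f : R3 → QH} {x : R3} (hf : DifferentiableAt ℝ f x) (c : ℝ) :
    CRbar (fun y => c • f y) x = c • CRbar f x := by
  simp [CRbar, pd, fderiv_fun_const_smul hf]

theorem CRbar_sum {ι : Type*} (s : Finset ι) {f : ι → R3 → QH} {x : R3}
    (hf : ∀ i ∈ s, DifferentiableAt ℝ (f i) x) :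
    CRbar (fun y => ∑ i ∈ s, f i y) x = ∑ i ∈ s, CRbar (f i) x := by
  simp [CRbar, pd, fderiv_fun_sum hf, Finset.mul_sum, Finset.sum_add_distrib]

/-- `toQ` as a continuous linear map. -/
def toQL : R3 →L[ℝ] QH := LinearMap.toContinuousLinearMap
  { toFun := toQ
    map_add' := fun x y => by ext <;> simp
    map_smul' := fun c x => by ext <;> simp }

/-- `toQbar` as a continuous linear map. -/
def toQbarL : R3 →L[ℝ] QH := LinearMap.toContinuousLinearMap
  { toFun := toQbar
    map_add' := fun x y => by ext <;> simp [add_comm]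
    map_smul' := fun c x => by ext <;> simp }

/-- `zeta` as a continuous linear map. -/
def zetaL : R3 →L[ℝ] QH := LinearMap.toContinuousLinearMap
  { toFun := zeta
    map_add' := fun x y => by ext <;> simp [add_comm]
    map_smul' := fun c x => by ext <;> simp }

theorem contDiff_toQ : ContDiff ℝ 1 toQ := toQL.contDiff
theorem contDiff_toQbar : ContDiff ℝ 1 toQbar := toQbarL.contDiff
theorem contDiff_zeta : ContDiff ℝ 1 zeta := zetaL.contDiff

theorem pd_toQ (i : Fin 3) (x : R3) : pd i toQ x = toQ (EuclideanSpace.single i 1) :=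
  congrArg (· (EuclideanSpace.single i 1)) (toQL.hasFDerivAt (x := x)).fderiv

theorem pd_toQbar (i : Fin 3) (x : R3) : pd i toQbar x = toQbar (EuclideanSpace.single i 1) :=
  congrArg (· (EuclideanSpace.single i 1)) (toQbarL.hasFDerivAt (x := x)).fderiv

theorem pd_zeta (i : Fin 3) (x : R3) : pd i zeta x = zeta (EuclideanSpace.single i 1) :=
  congrArg (· (EuclideanSpace.single i 1)) (zetaL.hasFDerivAt (x := x)).fderiv

/-- The monomials `x^a x̄^b ζ^l`. -/
def monom (a b l : ℕ) (x : R3) : QH := toQ x ^ a * toQbar x ^ b * zeta x ^ l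

theorem contDiff_monom (a b l : ℕ) : ContDiff ℝ 1 (monom a b l) :=
  ((contDiff_toQ.pow a).mul (contDiff_toQbar.pow b)).mul (contDiff_zeta.pow l)

theorem differentiableAt_monom (a b l : ℕ) (x : R3) : DifferentiableAt ℝ (monom a b l) x :=
  (contDiff_monom a b l).differentiable one_ne_zero x

/-- The coefficients of the Appell polynomial `A_n^l`, up to its normalising factor. -/
def appellCoeff (n l h : ℕ) : ℝ :=
  ((2 * n - 2 * h + 1).factorial * (2 * l + 2 * h).factorial : ℝ) /
    (h.factorial * (n - l - h).factorial * (n - h).factorial * (l + h).factorial)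

theorem appellCoeff_recursion (l h j : ℕ) :
    2 * (h + 1 : ℝ) * appellCoeff (l + (h + 1 + j)) l (h + 1) -
      (2 * l + 2 * h + 1) * appellCoeff (l + (h + 1 + j)) l h +
      (2 * l + 1) * appellCoeff (l + (h + 1 + j)) l (1 + j) = 0 := by
  have e1 : 2 * (l + (h + 1 + j)) - 2 * (h + 1) + 1 = 2 * l + 2 * j + 1 := by omega
  have e2 : 2 * (l + (h + 1 + j)) - 2 * h + 1 = 2 * l + 2 * j + 1 + 1 + 1 := by omega
  have e3 : 2 * (l + (h + 1 + j)) - 2 * (1 + j) + 1 = 2 * l + 2 * h + 1 := by omega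
  have e4 : l + (h + 1 + j) - l - (h + 1) = j := by omega
  have e5 : l + (h + 1 + j) - l - h = j + 1 := by omega
  have e6 : l + (h + 1 + j) - l - (1 + j) = h := by omega
  have e7 : l + (h + 1 + j) - (h + 1) = l + j := by omega
  have e8 : l + (h + 1 + j) - h = l + j + 1 := by omega
  have e9 : l + (h + 1 + j) - (1 + j) = l + h := by omega
  have e10 : 2 * l + 2 * (h + 1) = 2 * l + 2 * h + 1 + 1 := by omega
  have e11 : 2 * l + 2 * (1 + j) = 2 * l + 2 * j + 1 + 1 := by omega
  simp only [appellCoeff, e1, e2, e3, e4, e5, e6, e7, e8, e9, e10, e11]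
  simp only [add_comm 1 j, ← add_assoc l, Nat.factorial_succ]
  push_cast
  field_simp
  ring

theorem appellCoeff_last (l m : ℕ) :
    (2 * l + 2 * m + 1) * appellCoeff (l + m) l m = (2 * l + 1) * appellCoeff (l + m) l 0 := by
  have e1 : 2 * (l + m) - 2 * m + 1 = 2 * l + 1 := by omega
  have e2 : 2 * (l + m) - 2 * 0 + 1 = 2 * l + 2 * m + 1 := by omega
  simp only [appellCoeff, e1, e2]
  simp only [Nat.factorial_succ, add_tsub_cancel_left,
    add_tsub_cancel_right, tsub_self, tsub_zero, mul_zero, add_zero]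
  push_cast
  field_simp

theorem sum_appellCoeff (l m : ℕ) (X Y : ℂ) :
    ∑ h ∈ Finset.range (m + 1), (appellCoeff (l + m) l h : ℂ) *
      (2 * (m - h + 1 : ℕ) * (X ^ h * Y ^ (m - h)) * (X - Y) -
        (2 * l + 1) * (X ^ h * Y ^ (m - h + 1) - Y ^ h * X ^ (m - h + 1)) -
        (2 * (l + m) + 3) * (X ^ h * Y ^ (m - h)) * (X - Y)) = 0 := by
  set c : ℕ → ℂ := fun h => (appellCoeff (l + m) l h : ℂ) with hc
  have h1 : ∀ h ∈ Finset.range (m + 1), (appellCoeff (l + m) l h : ℂ) *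
      (2 * (m - h + 1 : ℕ) * (X ^ h * Y ^ (m - h)) * (X - Y) -
        (2 * l + 1) * (X ^ h * Y ^ (m - h + 1) - Y ^ h * X ^ (m - h + 1)) -
        (2 * (l + m) + 3) * (X ^ h * Y ^ (m - h)) * (X - Y)) =
      2 * h * c h * (X ^ h * Y ^ (m - h + 1)) -
        (2 * l + 2 * h + 1) * c h * (X ^ (h + 1) * Y ^ (m - h)) +
        (2 * l + 1) * c h * (X ^ (m - h + 1) * Y ^ h) := by
    intro h hh
    obtain ⟨j, rfl⟩ := Nat.exists_eq_add_of_le (Nat.lt_succ_iff.mp (Finset.mem_range.mp hh))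
    simp only [hc, add_tsub_cancel_left]
    push_cast
    ring
  rw [Finset.sum_congr rfl h1, Finset.sum_add_distrib, Finset.sum_sub_distrib,
    Finset.sum_range_succ', Finset.sum_range_succ (fun h => (2 * (l : ℂ) + 2 * h + 1) * c h * _),
    ← Finset.sum_range_reflect (fun h => (2 * (l : ℂ) + 1) * c h * _),
    Finset.sum_range_succ (fun h => (2 * (l : ℂ) + 1) * c (m + 1 - 1 - h) * _)]
  have hl : (2 * (l : ℂ) + 2 * m + 1) * c m = (2 * l + 1) * c 0 := by
    simp only [hc]; exact_mod_cast appellCoeff_last l m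
  have h2 : ∀ h ∈ Finset.range m,
      2 * ((h + 1 : ℕ) : ℂ) * c (h + 1) * (X ^ (h + 1) * Y ^ (m - (h + 1) + 1)) -
        (2 * l + 2 * h + 1) * c h * (X ^ (h + 1) * Y ^ (m - h)) +
        (2 * l + 1) * c (m + 1 - 1 - h) *
          (X ^ (m - (m + 1 - 1 - h) + 1) * Y ^ (m + 1 - 1 - h)) = 0 := by
    intro h hh
    obtain ⟨j, rfl⟩ := Nat.exists_eq_add_of_le (Nat.succ_le_of_lt (Finset.mem_range.mp hh))
    have e1 : h + 1 + j - (h + 1) + 1 = j + 1 := by omega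
    have e2 : h + 1 + j - h = j + 1 := by omega
    have e3 : h + 1 + j + 1 - 1 - h = 1 + j := by omega
    have e4 : h + 1 + j - (1 + j) + 1 = h + 1 := by omega
    have hr : 2 * ((h : ℂ) + 1) * c (h + 1) - (2 * l + 2 * h + 1) * c h +
      (2 * l + 1) * c (1 + j) = 0 := by
      simp only [hc]; exact_mod_cast appellCoeff_recursion l h j
    simp only [Nat.succ_eq_add_one, e1, e2, e3, e4]
    push_cast
    linear_combination X ^ (h + 1) * Y ^ (1 + j) * hr
  have h3 := Finset.sum_eq_zero h2
  rw [Finset.sum_add_distrib, Finset.sum_sub_distrib] at h3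
  simp only [Nat.add_sub_cancel, Nat.sub_self, Nat.sub_zero, Nat.cast_zero, pow_zero] at h3 ⊢
  linear_combination h3 - X ^ (m + 1) * hl

/-- The quaternion `u + s (x₁e₁ + x₂e₂)`. -/
def axial (x : R3) (u s : ℝ) : QH := ⟨u, s * x 1, s * x 2, 0⟩

@[simp] theorem axial_re (x : R3) (u s : ℝ) : (axial x u s).re = u := rfl
@[simp] theorem axial_imI (x : R3) (u s : ℝ) : (axial x u s).imI = s * x 1 := rfl
@[simp] theorem axial_imJ (x : R3) (u s : ℝ) : (axial x u s).imJ = s * x 2 := rfl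
@[simp] theorem axial_imK (x : R3) (u s : ℝ) : (axial x u s).imK = 0 := rfl

theorem toQ_eq_algHom_apply {x : R3} (hx : x 1 ≠ 0) :
    ∃ (φ : ℂ →ₐ[ℝ] QH) (z : ℂ), φ z = toQ x ∧ φ (star z) = toQbar x ∧ toQ x - toQbar x ≠ 0 ∧
      ∀ w, ∃ u s : ℝ, φ w = axial x u s ∧
        φ (star w) = axial x u (-s) := by
  set r := √(x 1 ^ 2 + x 2 ^ 2) with hr
  have hpos : 0 < x 1 ^ 2 + x 2 ^ 2 := by positivity
  have hr0 : r ≠ 0 := (Real.sqrt_pos.2 hpos).ne'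
  have hr2 : r ^ 2 = x 1 ^ 2 + x 2 ^ 2 := Real.sq_sqrt hpos.le
  let ω : QH := axial x 0 (1 / r)
  have hω : ω * ω = -1 := by
    ext <;> simp [ω]
    · field_simp
      linarith
    · ring
  have key : ∀ w : ℂ, Complex.liftAux ω hω w = axial x w.re (w.im / r) := by
    intro w
    rw [Complex.liftAux_apply]
    ext <;> simp [ω] <;> ring
  refine ⟨Complex.liftAux ω hω, ⟨x 0, r⟩, ?_, ?_, ?_, fun w => ⟨w.re, w.im / r, key w, ?_⟩⟩
  · rw [key]
    ext <;> simp [hr0]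
  · rw [key]
    ext <;> simp [hr0]
  · intro h
    have := congrArg QuaternionAlgebra.imI h
    simp at this
    exact hx (by linarith)
  · rw [key]
    ext <;> simp <;> ring

theorem zeta_commute (x y : R3) : Commute (zeta x) (zeta y) := by
  ext <;> simp <;> ring

theorem sum_basis_mul_toQ (f : QH) (hf : f.imK = 0) :
    f * toQ (EuclideanSpace.single 0 1) + e1 * f * toQ (EuclideanSpace.single 1 1) +
      e2 * f * toQ (EuclideanSpace.single 2 1) = -star f := by
  ext <;> simp [hf]

theorem sum_basis_mul_toQbar (f : QH) (hf : f.imK = 0) :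
    f * toQbar (EuclideanSpace.single 0 1) + e1 * f * toQbar (EuclideanSpace.single 1 1) +
      e2 * f * toQbar (EuclideanSpace.single 2 1) = 2 * f + star f := by
  rw [two_mul]
  ext <;> simp [hf]

theorem sum_basis_mul_zeta (x : R3) (u s : ℝ) :
    (toQ x - toQbar x) * (axial x u s * zeta (EuclideanSpace.single 0 1) +
      e1 * axial x u s * zeta (EuclideanSpace.single 1 1) +
      e2 * axial x u s * zeta (EuclideanSpace.single 2 1)) =
    -(2 : ℝ) • ((axial x u s - axial x u (-s)) * zeta x) := by
  ext <;> simp <;> ring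

theorem CRbar_monom {x : R3} {φ : ℂ →ₐ[ℝ] QH} {z : ℂ} (hz : φ z = toQ x)
    (hz' : φ (star z) = toQbar x)
    (hφ : ∀ w, ∃ u s : ℝ, φ w = axial x u s ∧
        φ (star w) = axial x u (-s)) (a b l : ℕ) :
    (toQ x - toQbar x) * CRbar (monom a b l) x =
      φ (2 * b * (z ^ a * star z ^ (b - 1)) * (z - star z) -
        (2 * l + 1) * (z ^ a * star z ^ b - star z ^ a * z ^ b)) * zeta x ^ l := by
  have hK : ∀ w, (φ w).imK = 0 := fun w => by
    obtain ⟨u, s, h, -⟩ := hφ w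
    rw [h, axial_imK]
  have hstar : ∀ w, star (φ w) = φ (star w) := fun w => by
    obtain ⟨u, s, h, h'⟩ := hφ w
    rw [h, h']
    ext <;> simp
  have hmon : ∀ a b l, monom a b l x = φ (z ^ a * star z ^ b) * zeta x ^ l := fun a b l => by
    simp [monom, ← hz, ← hz']
  have hmon_zero : ∀ a b, monom a b 0 x = φ (z ^ a * star z ^ b) := fun a b => by simp [hmon]
  have hd : toQ x - toQbar x = φ (z - star z) := by rw [map_sub, hz, hz']
  induction l with
  | zero =>
    induction b with
    | zero =>
      induction a with
      | zero =>
        have : monom 0 0 0 = fun _ => 1 := by ext1 y; simp [monom]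
        rw [this]
        simp [CRbar, pd]
      | succ a ih =>
        have : monom (a + 1) 0 0 = fun y => monom a 0 0 y * toQ y := by
          ext1 y; simp [monom, pow_succ]
        rw [this, CRbar_mul (differentiableAt_monom _ _ _ _)
          (contDiff_toQ.differentiable one_ne_zero x)]
        simp only [pd_toQ]
        rw [hmon_zero, sum_basis_mul_toQ _ (hK _), mul_add, ← mul_assoc, ih, hd,
          hstar, ← hz, pow_zero (zeta x), mul_one, mul_one, ← map_neg, ← map_mul, ← map_mul, ← map_add]
        congr 1
        simp
        ring
    | succ b ih =>
      have : monom a (b + 1) 0 = fun y => monom a b 0 y * toQbar y := by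
        ext1 y; simp [monom, pow_succ, mul_assoc]
      rw [this, CRbar_mul (differentiableAt_monom _ _ _ _)
        (contDiff_toQbar.differentiable one_ne_zero x)]
      simp only [pd_toQbar]
      rw [hmon_zero, sum_basis_mul_toQbar _ (hK _), mul_add, ← mul_assoc, ih, hd,
        hstar, ← hz', pow_zero (zeta x), mul_one, mul_one, ← map_ofNat φ 2, ← map_mul, ← map_mul,
        ← map_add, ← map_mul, ← map_add]
      congr 1
      cases b <;> simp <;> ring
  | succ l ih =>
    have : monom a b (l + 1) = fun y => monom a b l y * zeta y := by
      ext1 y; simp [monom, pow_succ, mul_assoc]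
    rw [this, CRbar_mul (differentiableAt_monom _ _ _ _)
      (contDiff_zeta.differentiable one_ne_zero x)]
    simp only [pd_zeta]
    have hcomm : ∀ (f : QH) (y : R3), f * zeta x ^ l * zeta y = f * zeta y * zeta x ^ l :=
      fun f y => by rw [mul_assoc, ((zeta_commute x y).pow_left l).eq, mul_assoc]
    obtain ⟨u, s, h, h'⟩ := hφ (z ^ a * star z ^ b)
    have hb := sum_basis_mul_zeta x u s
    rw [← h, ← h'] at hb
    rw [hmon, mul_add, ← mul_assoc, ih, ← mul_assoc e1, ← mul_assoc e2, hcomm _ (.single 0 1),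
      hcomm _ (.single 1 1), hcomm _ (.single 2 1),
      ← add_mul, ← add_mul, ← mul_assoc (toQ x - toQbar x) (_ + _), hb, mul_assoc (φ _), ← pow_succ, smul_mul_assoc,
      mul_assoc (_ - _) (zeta x), ← pow_succ', ← smul_mul_assoc, ← map_sub, ← map_smul, ← add_mul, ← map_add]
    congr 2
    simp
    ring

/-- The polynomial `x̄^d Σ_h c_h x^h x̄^(m-h) ζ^l`; for `d = 1` it is the numerator of the Kelvin
transform of `A_{l+m}^l`. -/
def kelvinPoly (l m d : ℕ) (x : R3) : QH :=
  ∑ h ∈ Finset.range (m + 1), appellCoeff (l + m) l h • monom h (m - h + d) l x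

theorem contDiff_kelvinPoly (l m d : ℕ) : ContDiff ℝ 1 (kelvinPoly l m d) :=
  ContDiff.sum fun _ _ => (contDiff_monom _ _ _).const_smul _

theorem continuous_CRbar {f : R3 → QH} (hf : ContDiff ℝ 1 f) : Continuous (CRbar f) := by
  have h : ∀ i, Continuous (pd i f) := fun i =>
    (hf.continuous_fderiv one_ne_zero).clm_apply continuous_const
  exact ((h 0).add (continuous_const.mul (h 1))).add (continuous_const.mul (h 2))

theorem CRbar_kelvinPoly_of_ne {l m : ℕ} {x : R3} (hx : x 1 ≠ 0) :
    CRbar (kelvinPoly l m 1) x = (2 * (l + m) + 3 : ℝ) • kelvinPoly l m 0 x := by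
  obtain ⟨φ, z, hz, hz', hne, hφ⟩ := toQ_eq_algHom_apply hx
  apply mul_left_cancel₀ hne
  have hsum := congrArg (fun w => φ w * zeta x ^ l) (sum_appellCoeff l m z (star z))
  simp only [map_sum, map_zero, zero_mul, Finset.sum_mul] at hsum
  unfold kelvinPoly
  rw [CRbar_sum (f := fun h y => appellCoeff (l + m) l h • monom h (m - h + 1) l y) _
    fun i _ => (differentiableAt_monom _ _ _ _).fun_const_smul _, Finset.mul_sum,
    Finset.smul_sum, Finset.mul_sum, ← sub_eq_zero, ← Finset.sum_sub_distrib, ← hsum]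
  refine Finset.sum_congr rfl fun h _ => ?_
  have hd : toQ x - toQbar x = φ (z - star z) := by rw [map_sub, hz, hz']
  have hmon : monom h (m - h + 0) l x = φ (z ^ h * star z ^ (m - h)) * zeta x ^ l := by
    simp [monom, ← hz, ← hz']
  rw [CRbar_const_smul (differentiableAt_monom _ _ _ _), mul_smul_comm,
    CRbar_monom hz hz' hφ, hd, hmon, smul_smul, mul_smul_comm,
    ← mul_assoc (φ (z - star z)), ← map_mul,
    ← smul_mul_assoc, ← smul_mul_assoc, ← map_smul, ← map_smul, ← sub_mul, ← map_sub]
  congr 2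
  simp only [Complex.real_smul, Nat.add_sub_cancel]
  push_cast
  ring

theorem CRbar_kelvinPoly (l m : ℕ) (x : R3) :
    CRbar (kelvinPoly l m 1) x = (2 * (l + m) + 3 : ℝ) • kelvinPoly l m 0 x := by
  by_cases hx : x 1 = 0
  · have hline : Continuous fun t : ℝ => x + t • EuclideanSpace.single (1 : Fin 3) (1 : ℝ) := by
      fun_prop
    have h := Continuous.ext_on (dense_compl_singleton (0 : ℝ))
      ((continuous_CRbar (contDiff_kelvinPoly l m 1)).comp hline)
      (((contDiff_kelvinPoly l m 0).continuous.const_smul (2 * (l + m) + 3 : ℝ)).comp hline)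
      fun t ht => CRbar_kelvinPoly_of_ne (by simpa [hx] using ht)
    simpa using congrFun h 0
  · exact CRbar_kelvinPoly_of_ne hx

theorem hasFDerivAt_inv_norm_pow {x : R3} (hx : x ≠ 0) (k : ℕ) :
    HasFDerivAt (fun y : R3 => (‖y‖ ^ k)⁻¹) ((-(k : ℝ) * (‖x‖ ^ (k + 2))⁻¹) • innerSL ℝ x) x := by
  have hx' : ‖x‖ ≠ 0 := norm_ne_zero_iff.2 hx
  have h := (hasStrictFDerivAt_norm_sq x).hasFDerivAt.sqrt (pow_ne_zero 2 hx')
  simp only [Real.sqrt_sq (norm_nonneg _)] at h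
  have h2 := ((hasDerivAt_pow k ‖x‖).inv (pow_ne_zero k hx')).comp_hasFDerivAt x h
  refine h2.congr_fderiv ?_
  ext v
  simp
  rcases k with _ | k
  · simp
  · simp
    field_simp
    ring

theorem toQ_mul_toQbar (x : R3) : toQ x * toQbar x = ‖x‖ ^ 2 • 1 := by
  rw [EuclideanSpace.norm_sq_eq, Fin.sum_univ_three]
  ext <;> simp <;> ring

theorem toQ_mul_kelvinPoly (l m : ℕ) (x : R3) :
    toQ x * kelvinPoly l m 1 x = ‖x‖ ^ 2 • kelvinPoly l m 0 x := by
  have hc : Commute (toQ x) (toQbar x) := by ext <;> simp <;> ring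
  simp only [kelvinPoly, Finset.mul_sum, Finset.smul_sum]
  refine Finset.sum_congr rfl fun h _ => ?_
  rw [mul_smul_comm, smul_comm]
  congr 1
  simp only [monom, add_zero]
  rw [← mul_assoc, pow_succ', ← mul_assoc, ← mul_assoc, ← pow_succ', pow_succ, mul_assoc (_ ^ h),
    toQ_mul_toQbar]
  simp

theorem CRbar_inv_norm_pow_smul {f : R3 → QH} {x : R3} (hx : x ≠ 0)
    (hf : DifferentiableAt ℝ f x) (k : ℕ) :
    CRbar (fun y => (‖y‖ ^ k)⁻¹ • f y) x =
      (‖x‖ ^ k)⁻¹ • CRbar f x - (k * (‖x‖ ^ (k + 2))⁻¹ : ℝ) • (toQ x * f x) := by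
  have hd := hasFDerivAt_inv_norm_pow hx k
  have hp : ∀ i, pd i (fun y => (‖y‖ ^ k)⁻¹ • f y) x =
      (‖x‖ ^ k)⁻¹ • pd i f x - (k * (‖x‖ ^ (k + 2))⁻¹ * x i : ℝ) • f x := fun i => by
    simp [pd, fderiv_fun_smul hd.differentiableAt hf, hd.fderiv, sub_eq_add_neg,
      EuclideanSpace.inner_single_right]
  have hq : toQ x = x 0 • 1 + x 1 • e1 + x 2 • e2 := by ext <;> simp
  simp only [CRbar, hp, hq, mul_sub, add_mul, smul_mul_assoc, one_mul, mul_smul_comm, smul_add,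
    smul_smul]
  abel

theorem kelvin_appell_eq (l m : ℕ) : ∃ C : ℝ, ∀ x : R3, kelvin (appell (l + m) l) x =
    C • (‖x‖ ^ (2 * (l + m) + 3))⁻¹ • kelvinPoly l m 1 x := by
  refine ⟨(((l + m).factorial * l.factorial : ℝ) /
      (2 ^ (2 * (l + m - l)) * (l + m + l + 1).factorial * (2 * l).factorial)) * (-1) ^ l,
    fun x => ?_⟩
  have h1 : toQ ((‖x‖ ^ 2)⁻¹ • barPt x) = (‖x‖ ^ 2)⁻¹ • toQbar x := by
    ext <;> simp [barPt, mk3]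
  have h2 : toQbar ((‖x‖ ^ 2)⁻¹ • barPt x) = (‖x‖ ^ 2)⁻¹ • toQ x := by
    ext <;> simp [barPt, mk3]
  have h3 : zeta ((‖x‖ ^ 2)⁻¹ • barPt x) = (-(‖x‖ ^ 2)⁻¹) • zeta x := by
    ext <;> simp [barPt, mk3]
  have hc : Commute (toQ x) (toQbar x) := by ext <;> simp <;> ring
  simp only [kelvin, appell, kelvinPoly, h1, h2, h3, Finset.smul_sum, Finset.sum_mul,
    Finset.mul_sum, add_tsub_cancel_left]
  refine Finset.sum_congr rfl fun h hh => ?_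
  have hm : h ≤ m := Nat.lt_succ_iff.1 (Finset.mem_range.1 hh)
  obtain ⟨j, rfl⟩ := Nat.exists_eq_add_of_le hm
  have hmul : toQbar x * (toQ x ^ h * toQbar x ^ j * zeta x ^ l) = monom h (j + 1) l x := by
    rw [monom, ← mul_assoc, ← mul_assoc, ← (hc.pow_left h).eq, mul_assoc (_ ^ h), ← pow_succ']
  simp only [smul_pow, smul_mul_assoc, mul_smul_comm, smul_smul, hmul, add_tsub_cancel_left,
    appellCoeff]
  congr 1
  rw [neg_pow]
  ring

theorem monom_smul (a b l : ℕ) (t : ℝ) (x : R3) :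
    monom a b l (t • x) = t ^ (a + b + l) • monom a b l x := by
  have h1 : toQ (t • x) = t • toQ x := toQL.map_smul t x
  have h2 : toQbar (t • x) = t • toQbar x := toQbarL.map_smul t x
  have h3 : zeta (t • x) = t • zeta x := zetaL.map_smul t x
  simp only [monom, h1, h2, h3, smul_pow, smul_mul_assoc, mul_smul_comm, smul_smul]
  congr 1
  ring

theorem kelvinPoly_smul (l m d : ℕ) (t : ℝ) (x : R3) :
    kelvinPoly l m d (t • x) = t ^ (l + m + d) • kelvinPoly l m d x := by
  simp only [kelvinPoly, Finset.smul_sum, monom_smul]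
  refine Finset.sum_congr rfl fun h hh => ?_
  have hm : h ≤ m := Nat.lt_succ_iff.1 (Finset.mem_range.1 hh)
  rw [smul_comm, show h + (m - h + d) + l = l + m + d by omega]

/-- the Kelvin transform K(A_n^l) is monogenic on ℝ³\{0} and
homogeneous of degree -(n+2). -/
theorem kelvin_appell_monogenic_homogeneous (n l : ℕ) (hl : l ≤ n) :
    (∀ x : R3, x ≠ 0 → DifferentiableAt ℝ (kelvin (appell n l)) x) ∧
    (∀ x : R3, x ≠ 0 → CRbar (kelvin (appell n l)) x = 0) ∧
    (∀ t : ℝ, 0 < t → ∀ x : R3, x ≠ 0 →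
      kelvin (appell n l) (t • x) = (t ^ (-((n : ℤ) + 2))) • kelvin (appell n l) x) := by
  obtain ⟨m, rfl⟩ := Nat.exists_eq_add_of_le hl
  obtain ⟨C, hC⟩ := kelvin_appell_eq l m
  have hpoly : ∀ x, DifferentiableAt ℝ (kelvinPoly l m 1) x :=
    (contDiff_kelvinPoly l m 1).differentiable one_ne_zero
  have hdiff : ∀ x : R3, x ≠ 0 → DifferentiableAt ℝ
      (fun y => (‖y‖ ^ (2 * (l + m) + 3))⁻¹ • kelvinPoly l m 1 y) x := fun x hx =>
    (hasFDerivAt_inv_norm_pow hx _).differentiableAt.smul (hpoly x)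
  rw [funext hC]
  refine ⟨fun x hx => (hdiff x hx).const_smul C, fun x hx => ?_, fun t ht x hx => ?_⟩
  · have hx' : ‖x‖ ≠ 0 := norm_ne_zero_iff.2 hx
    rw [CRbar_const_smul (hdiff x hx), CRbar_inv_norm_pow_smul hx (hpoly x), CRbar_kelvinPoly,
      toQ_mul_kelvinPoly, smul_smul, smul_smul, ← sub_smul]
    convert smul_zero C
    convert zero_smul ℝ _
    push_cast
    field_simp
    ring
  · beta_reduce
    rw [kelvinPoly_smul, norm_smul, Real.norm_of_nonneg ht.le, smul_comm _ C]
    congr 1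
    rw [smul_smul, smul_smul]
    congr 1
    rw [zpow_neg, show ((l + m : ℕ) : ℤ) + 2 = ((l + m + 2 : ℕ) : ℤ) by push_cast; ring,
      zpow_natCast]
    field_simp
    ring
end
end

section
/- For every integer n ≥ 0 and every x ∈ ℝ³ ∖ {0}, the outer Appell function on the diagonal has the explicit form A_{−(n+2)}^n(x) = ((−1)^n·(2n+1)!/(n!·(n+1)!))·x̄·ζ^n/|x|^{2n+3}, where ζ = x₁ − x₂e₃; in particular A_{−2}^0(x) = x̄/|x|³, i.e. 4π times the Cauchy kernel E₂(x) = (1/(4π))·x̄/|x|³. -/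
open MeasureTheory Metric Finset

noncomputable section

/-- The diagonal Appell polynomial is a power of `ζ`. -/
theorem appell_self (n : ℕ) (x : R3) : appell n n x = zeta x ^ n := by
  have hc : ((n.factorial * n.factorial : ℝ) /
      (2 ^ (2 * (n - n)) * (n + n + 1).factorial * (2 * n).factorial)) *
      (((2 * n + 1).factorial * (2 * n).factorial : ℝ) /
        (n.factorial * n.factorial)) = 1 := by
    rw [Nat.sub_self, ← two_mul]
    field_simp
    simp
  simpa [appell, smul_smul] using congrArg (· • zeta x ^ n) hc

/-- `ζ` is odd and homogeneous of degree one under the conjugated scaling. -/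
theorem zeta_smul_barPt (c : ℝ) (x : R3) : zeta (c • barPt x) = (-c) • zeta x := by
  ext <;> simp only [Quaternion.re_smul, Quaternion.imI_smul, Quaternion.imJ_smul,
    Quaternion.imK_smul] <;> simp [zeta, barPt, mk3]

/-- the explicit form of the outer Appell functions on the diagonal,
and the relation of A_{-2}^0 to the Cauchy kernel. -/
theorem outer_appell_diagonal (n : ℕ) (x : R3) (hx : x ≠ 0) :
    (outerAppell n n x =
      (((-1 : ℝ) ^ n * (2 * n + 1).factorial) / (n.factorial * (n + 1).factorial)) •
        ((‖x‖ ^ (2 * n + 3))⁻¹ • (toQbar x * zeta x ^ n))) ∧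
    outerAppell 0 0 x = (‖x‖ ^ 3)⁻¹ • toQbar x ∧
    outerAppell 0 0 x = (4 * Real.pi) • ((1 / (4 * Real.pi)) • ((‖x‖ ^ 3)⁻¹ • toQbar x)) := by
  have hpi : (4 * Real.pi) ≠ 0 := by positivity
  have main (m : ℕ) : outerAppell m m x =
      (((-1 : ℝ) ^ m * (2 * m + 1).factorial) / (m.factorial * (m + 1).factorial)) •
        ((‖x‖ ^ (2 * m + 3))⁻¹ • (toQbar x * zeta x ^ m)) := by
    have hnorm : ‖x‖ ≠ 0 := norm_ne_zero_iff.mpr hx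
    rw [outerAppell, kelvin, appell_self, zeta_smul_barPt, smul_pow, smul_mul_smul_comm,
      smul_smul, smul_smul, Nat.sub_self, ← two_mul, neg_pow, inv_pow, ← pow_mul]
    congr 1
    simp only [Nat.factorial_zero, Nat.cast_one, mul_one]
    field_simp
    ring
  have cauchy : outerAppell 0 0 x = (‖x‖ ^ 3)⁻¹ • toQbar x := by
    simpa using main 0
  refine ⟨main n, cauchy, ?_⟩
  rw [smul_smul, mul_one_div_cancel hpi, one_smul, cauchy]
end
end
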